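/- arXiv:2408.06344 — 2 statements merged into one kernel-verified Lean document; each statement's English description precedes it below -/
import Mathlib

section
/- For every nonempty duplicate-free list c of elements of Fin n and every node q in Fin n, the sum over p of M(c) p q equals 1 if q is a member of c and equals 0 otherwise. -/
open Classical in
/-- Cyclic adjacency matrix of a list `c` over `Fin n`: entry `(p, q)` is `1` iff
`(p, q)` occurs as a cyclically consecutive pair of nodes in `c`. -/
noncomputable def cycleMatrix {n : ℕ} (c : List (Fin n)) : Matrix (Fin n) (Fin n) ℝ :=
  fun p q =>
    if (∃ i : ℕ, ∃ h : i < c.length, c.get ⟨i, h⟩ = p ∧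
        c.get ⟨(i + 1) % c.length,
          Nat.mod_lt _ (Nat.lt_of_le_of_lt (Nat.zero_le i) h)⟩ = q)
    then 1 else 0

open Classical
theorem col_sum_cycleMatrix {n : ℕ} (c : List (Fin n)) (hne : c ≠ []) (hnd : c.Nodup)
    (q : Fin n) :
    (∑ p, cycleMatrix c p q) = if q ∈ c then 1 else 0 := by
  by_cases hq : q ∈ c
  · rw [if_pos hq]
    obtain ⟨j, hj, rfl⟩ := List.mem_iff_getElem.mp hq
    obtain ⟨k, hk, hkj⟩ : ∃ k, k < c.length ∧ (k + 1) % c.length = j := by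
      rcases j with _ | j
      · exact ⟨c.length - 1, by omega, by rw [Nat.sub_add_cancel hj, Nat.mod_self]⟩
      · exact ⟨j, by omega, Nat.mod_eq_of_lt hj⟩
    have huniq : ∀ i, i < c.length → (i + 1) % c.length = j → i = k := by
      intro i hi hij
      have hmod : i + 1 ≡ k + 1 [MOD c.length] := hij.trans hkj.symm
      exact (Nat.ModEq.add_right_cancel' 1 hmod).eq_of_lt_of_lt hi hk
    refine (Finset.sum_eq_single (c.get ⟨k, hk⟩) ?_ ?_).trans ?_
    · rintro p - hp
      refine if_neg ?_
      rintro ⟨i, hi, rfl, h⟩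
      obtain rfl := huniq i hi (hnd.getElem_inj_iff.mp h)
      exact hp rfl
    · exact fun h => absurd (Finset.mem_univ _) h
    · exact if_pos ⟨k, hk, rfl, by simp [hkj]⟩
  · rw [if_neg hq]
    refine Finset.sum_eq_zero fun p _ => if_neg ?_
    rintro ⟨i, hi, -, rfl⟩
    exact hq (List.get_mem _ _)
end

section
/- For every nonempty duplicate-free list c of elements of Fin n, the matrix M(c) is premagic: for every node a in Fin n, the sum of the entries in row a of M(c) equals the sum of the entries in column a of M(c). -/
open Classical

theorem cycleMatrix_apply_eq_formPerm {n : ℕ} {c : List (Fin n)} (hnd : c.Nodup) (p q : Fin n) :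
    cycleMatrix c p q = if p ∈ c ∧ c.formPerm p = q then 1 else 0 := by
  unfold cycleMatrix
  refine if_congr ⟨?_, ?_⟩ rfl rfl
  · rintro ⟨i, hi, rfl, rfl⟩
    exact ⟨List.get_mem _ _, List.formPerm_apply_getElem c hnd i hi⟩
  · rintro ⟨hp, rfl⟩
    obtain ⟨i, hi, rfl⟩ := List.getElem_of_mem hp
    exact ⟨i, hi, rfl, (List.formPerm_apply_getElem c hnd i hi).symm⟩

theorem sum_cycleMatrix_row {n : ℕ} {c : List (Fin n)} (hnd : c.Nodup) (a : Fin n) :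
    ∑ r, cycleMatrix c a r = if a ∈ c then 1 else 0 := by
  simp [cycleMatrix_apply_eq_formPerm hnd, ite_and]

theorem sum_cycleMatrix_col {n : ℕ} {c : List (Fin n)} (hnd : c.Nodup) (a : Fin n) :
    ∑ r, cycleMatrix c r a = if a ∈ c then 1 else 0 := by
  have h (r : Fin n) : cycleMatrix c r a = if c.formPerm r = a ∧ a ∈ c then 1 else 0 := by
    rw [cycleMatrix_apply_eq_formPerm hnd]
    refine if_congr ⟨?_, ?_⟩ rfl rfl
    · rintro ⟨hr, rfl⟩
      exact ⟨rfl, List.formPerm_mem_iff_mem.2 hr⟩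
    · rintro ⟨rfl, hr⟩
      exact ⟨List.formPerm_mem_iff_mem.1 hr, rfl⟩
  simp_rw [h]
  rw [Equiv.sum_comp c.formPerm fun s => if s = a ∧ a ∈ c then (1 : ℝ) else 0]
  simp [ite_and]

theorem cycleMatrix_premagic {n : ℕ} (c : List (Fin n)) (hne : c ≠ []) (hnd : c.Nodup)
    (a : Fin n) :
    (∑ r, cycleMatrix c a r) = ∑ r, cycleMatrix c r a := by
  rw [sum_cycleMatrix_row hnd, sum_cycleMatrix_col hnd]
end
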